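/- Let ω : {0,…,p−2} → ℤ≥0 be antipalindromic with range {0,1,…,ζ}, and let a > 0 and b ≥ 0 be integers. Define ω′(j) = a·ω(j) + b. Then the distribution of φ_{ω′}^(m) is palindromic on its range: for every m ≥ 0 and every j with 0 ≤ j ≤ m·a·ζ, one has π_m^{ω′}(mb + j) = π_m^{ω′}(m(aζ + b) − j). -/

import Mathlib

open MeasureTheory
open scoped NNReal ENNReal

namespace Chacon

/-- The space of digit sequences with digits in `{0, …, p-1}`. -/
def Gamma (p : ℕ) : Set (ℕ → ℕ) := {x | ∀ i, x i < p}

/-- `Γ*`: sequences with digits `< p` having infinitely many coordinates `≠ p - 1`. -/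
def GammaStar (p : ℕ) : Set (ℕ → ℕ) :=
  {x | (∀ i, x i < p) ∧ {i | x i ≠ p - 1}.Infinite}

/-- The least index `i` with `x i ≠ p - 1`. -/
noncomputable def firstNot (p : ℕ) (x : ℕ → ℕ) : ℕ :=
  sInf {i | x i ≠ p - 1}

/-- `φ(x) = x_i` where `i` is the least index with `x_i ≠ p - 1`. -/
noncomputable def phi (p : ℕ) (x : ℕ → ℕ) : ℕ :=
  x (firstNot p x)

/-- The odometer `S` (addition of `1` with carry): the initial run of digits
`p - 1` is replaced by zeros, and the first digit `≠ p - 1` is increased by one. -/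
noncomputable def odo (p : ℕ) (x : ℕ → ℕ) : ℕ → ℕ :=
  fun i =>
    if i < firstNot p x then 0
    else if i = firstNot p x then x i + 1
    else x i

/-- `φ^(m)(x) = ∑_{j=0}^{m-1} φ(S^j x)`. -/
noncomputable def phiSum (p m : ℕ) (x : ℕ → ℕ) : ℕ :=
  ∑ j ∈ Finset.range m, phi p ((odo p)^[j] x)

/-- The base-`p` digit sequence of a real number `u`. -/
noncomputable def digitsOf (p : ℕ) (u : ℝ) : ℕ → ℕ :=
  fun i => (⌊u * (p : ℝ) ^ (i + 1)⌋).toNat % p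

/-- `λ`: the product probability measure on digit sequences under which the
coordinates are i.i.d., uniformly distributed in `{0, …, p-1}`; it is realized
concretely as the distribution of the base-`p` digit sequence of a uniformly
distributed random point of `[0,1)`. -/
noncomputable def lam (p : ℕ) : Measure (ℕ → ℕ) :=
  Measure.map (digitsOf p) (volume.restrict (Set.Ico (0 : ℝ) 1))

/-- `π_m(j) = λ({x : φ^(m)(x) = j})`. -/
noncomputable def pim (p m j : ℕ) : ℝ≥0∞ :=
  lam p {x | phiSum p m x = j}

/-- `P_m^p(t) = ∑_{j ≥ 0} π_m(j) t^j`, a real polynomial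
(the sum is over `0 ≤ j ≤ m (p-2)` since `0 ≤ φ^(m) ≤ m (p-2)` a.s.). -/
noncomputable def P (p m : ℕ) (t : ℝ) : ℝ :=
  ∑ j ∈ Finset.range (m * (p - 2) + 1), (pim p m j).toReal * t ^ j

/-- The `n`-th triangular number `Δ_n = n (n+1) / 2`. -/
def tri (n : ℕ) : ℕ := n * (n + 1) / 2

/-- The degree `D_m` of `P_m^p`: the largest `j` with `π_m(j) ≠ 0`. -/
noncomputable def D (p m : ℕ) : ℕ := sSup {j | pim p m j ≠ 0}

/-- The lower degree `d_m` of `P_m^p`: the least `j` with `π_m(j) ≠ 0`. -/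
noncomputable def d (p m : ℕ) : ℕ := sInf {j | pim p m j ≠ 0}


/-- `φ_ω(x) = ω(x_i)` where `i` is the least index with `x_i ≠ p - 1`. -/
noncomputable def phiOmega (p : ℕ) (ω : ℕ → ℕ) (x : ℕ → ℕ) : ℕ :=
  ω (x (firstNot p x))

/-- `φ_ω^(m)(x) = ∑_{j=0}^{m-1} φ_ω(S^j x)`. -/
noncomputable def phiOmegaSum (p : ℕ) (ω : ℕ → ℕ) (m : ℕ) (x : ℕ → ℕ) : ℕ :=
  ∑ j ∈ Finset.range m, phiOmega p ω ((odo p)^[j] x)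

/-- `π_m^ω(j) = λ({x : φ_ω^(m)(x) = j})`. -/
noncomputable def pimOmega (p : ℕ) (ω : ℕ → ℕ) (m j : ℕ) : ℝ≥0∞ :=
  lam p {x | phiOmegaSum p ω m x = j}

/-- `ω : {0, …, p-2} → ℤ≥0` is antipalindromic with range exactly `{0, 1, …, ζ}`
and `ω j = ζ - ω (p - 2 - j)` for all `0 ≤ j ≤ p - 2`. -/
def Antipalindromic (p ζ : ℕ) (ω : ℕ → ℕ) : Prop :=
  (∀ j, j ≤ p - 2 → ω j ≤ ζ) ∧
  (∀ v, v ≤ ζ → ∃ j, j ≤ p - 2 ∧ ω j = v) ∧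
  (∀ j, j ≤ p - 2 → ω j + ω (p - 2 - j) = ζ)

/-- The digitwise complement `x_i ↦ p - 1 - x_i`, i.e. `x ↦ -1 - x` on `p`-adic integers. -/
def compl (p : ℕ) (x : ℕ → ℕ) : ℕ → ℕ := fun i => p - 1 - x i

/-- Digit sequences in `Γ` that are not constantly `p - 1`. -/
def GammaNe (p : ℕ) : Set (ℕ → ℕ) := {x | (∀ i, x i < p) ∧ ∃ i, x i ≠ p - 1}

/-- The sequences sharing their first `n` digits with `d`. -/
def cyl (n : ℕ) (d : ℕ → ℕ) : Set (ℕ → ℕ) := {x | ∀ i < n, x i = d i}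

theorem lt_firstNot_iff (p : ℕ) (x : ℕ → ℕ) (k : ℕ) :
    k < firstNot p x ↔ (∃ i, x i ≠ p - 1) ∧ ∀ i ≤ k, x i = p - 1 := by
  constructor
  · intro h
    refine ⟨?_, fun i hi => ?_⟩
    · by_contra! hne
      have : {i | x i ≠ p - 1} = ∅ := by ext i; simp [hne]
      simp [firstNot, this] at h
    · by_contra hne
      exact Nat.notMem_of_lt_sInf (lt_of_le_of_lt hi h) hne
  · rintro ⟨hne, h⟩
    by_contra! hle
    exact Nat.sInf_mem (s := {i | x i ≠ p - 1}) hne (h _ hle)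

theorem apply_firstNot_ne {p : ℕ} {x : ℕ → ℕ} (h : ∃ i, x i ≠ p - 1) :
    x (firstNot p x) ≠ p - 1 :=
  Nat.sInf_mem (s := {i | x i ≠ p - 1}) h

theorem apply_of_lt_firstNot {p : ℕ} {x : ℕ → ℕ} {i : ℕ} (h : i < firstNot p x) :
    x i = p - 1 :=
  ((lt_firstNot_iff p x i).1 h).2 i le_rfl

theorem firstNot_eq {p : ℕ} {x : ℕ → ℕ} {k : ℕ} (hlt : ∀ i < k, x i = p - 1)
    (hk : x k ≠ p - 1) : firstNot p x = k := by
  refine le_antisymm (Nat.sInf_le hk) ?_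
  by_contra! h
  exact apply_firstNot_ne ⟨k, hk⟩ (hlt _ h)

theorem odo_lt {p : ℕ} {x : ℕ → ℕ} (hx : x ∈ GammaNe p) (i : ℕ) : odo p x i < p := by
  have h1 := hx.1 i
  have h2 := apply_firstNot_ne hx.2
  unfold odo
  split_ifs with h h'
  · omega
  · subst h'; omega
  · exact h1

theorem compl_compl {p : ℕ} {x : ℕ → ℕ} (hx : ∀ i, x i < p) : compl p (compl p x) = x := by
  funext i
  have := hx i
  simp only [compl]
  omega

theorem compl_lt {p : ℕ} (hp : 0 < p) (x : ℕ → ℕ) (i : ℕ) : compl p x i < p := by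
  simp only [compl]
  omega

theorem compl_odo_apply_firstNot (p : ℕ) (x : ℕ → ℕ) :
    compl p (odo p x) (firstNot p x) = p - 2 - x (firstNot p x) := by
  simp only [compl, odo, lt_irrefl, if_false, if_true]
  omega

theorem compl_odo_apply_firstNot_ne {p : ℕ} (hp : 2 ≤ p) (x : ℕ → ℕ) :
    compl p (odo p x) (firstNot p x) ≠ p - 1 := by
  rw [compl_odo_apply_firstNot]
  omega

theorem compl_odo_mem {p : ℕ} (hp : 2 ≤ p) (x : ℕ → ℕ) : compl p (odo p x) ∈ GammaNe p :=
  ⟨compl_lt (by omega) _, _, compl_odo_apply_firstNot_ne hp x⟩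

theorem firstNot_compl_odo {p : ℕ} (hp : 2 ≤ p) (x : ℕ → ℕ) :
    firstNot p (compl p (odo p x)) = firstNot p x :=
  firstNot_eq (fun i hi => by simp [compl, odo, hi]) (compl_odo_apply_firstNot_ne hp x)

theorem odo_compl_odo {p : ℕ} (hp : 2 ≤ p) {x : ℕ → ℕ} (hx : x ∈ GammaNe p) :
    odo p (compl p (odo p x)) = compl p x := by
  funext i
  have h1 := hx.1 i
  have h2 := apply_firstNot_ne hx.2
  rw [odo, firstNot_compl_odo hp]
  split_ifs with h h'
  · simp [compl, apply_of_lt_firstNot h]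
  · subst h'
    rw [compl_odo_apply_firstNot]
    simp only [compl]
    omega
  · simp [compl, odo, h, h']

theorem odo_congr {p n : ℕ} {x y : ℕ → ℕ} (hx : ∃ i, x i ≠ p - 1) (hy : ∃ i, y i ≠ p - 1)
    (h : x ∈ cyl n y) : odo p x ∈ cyl n (odo p y) := by
  intro i hi
  have key : ∀ j ≤ i, (j < firstNot p x ↔ j < firstNot p y) := by
    intro j hj
    rw [lt_firstNot_iff, lt_firstNot_iff]
    refine and_congr (iff_of_true hx hy) (forall₂_congr fun k hk => ?_)
    rw [h k (by omega)]
  have e1 := key i le_rfl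
  have e2 : i = firstNot p x ↔ i = firstNot p y := by
    rcases Nat.eq_zero_or_pos i with h0 | h0
    · omega
    · have := key (i - 1) (by omega)
      omega
  simp only [odo, e1, e2, h i hi]

theorem compl_congr {p n : ℕ} {x y : ℕ → ℕ} (h : x ∈ cyl n y) :
    compl p x ∈ cyl n (compl p y) := fun i hi => by simp only [compl, h i hi]

theorem odo_mem_cyl_iff {p n : ℕ} (hp : 2 ≤ p) {x d : ℕ → ℕ} (hx : x ∈ GammaNe p)
    (hd : ∀ i, d i < p) (hd' : ∃ i, d i ≠ 0) :
    odo p x ∈ cyl n d ↔ x ∈ cyl n (compl p (odo p (compl p d))) := by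
  have hc : compl p d ∈ GammaNe p := by
    refine ⟨compl_lt (by omega) d, ?_⟩
    obtain ⟨i, hi⟩ := hd'
    refine ⟨i, ?_⟩
    have := hd i
    simp only [compl]
    omega
  constructor
  · intro h
    have := compl_congr (p := p) (odo_congr (compl_odo_mem hp x).2 hc.2 (compl_congr h))
    rwa [odo_compl_odo hp hx, compl_compl hx.1] at this
  · intro h
    have := odo_congr hx.2 (compl_odo_mem hp _).2 h
    rwa [odo_compl_odo hp hc, compl_compl hd] at this

theorem compl_mem_cyl_iff {p n : ℕ} {x d : ℕ → ℕ} (hx : ∀ i, x i < p) (hd : ∀ i, d i < p) :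
    compl p x ∈ cyl n d ↔ x ∈ cyl n (compl p d) := by
  constructor
  · intro h
    simpa [compl_compl hx] using compl_congr (p := p) h
  · intro h
    simpa [compl_compl hd] using compl_congr (p := p) h

theorem measurable_compl (p : ℕ) : Measurable (compl p) :=
  measurable_pi_iff.2 fun i => (measurable_of_countable fun k : ℕ => p - 1 - k).comp
    (measurable_pi_apply i)

theorem measurableSet_apply_eq (i c : ℕ) : MeasurableSet {x : ℕ → ℕ | x i = c} :=
  measurableSet_eq_fun (measurable_pi_apply i) measurable_const

theorem measurableSet_cyl (n : ℕ) (d : ℕ → ℕ) : MeasurableSet (cyl n d) := by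
  have : cyl n d = ⋂ i, ⋂ _ : i < n, {x | x i = d i} := by ext; simp [cyl]
  rw [this]
  exact .iInter fun i => .iInter fun _ => measurableSet_apply_eq i _

theorem measurable_firstNot (p : ℕ) : Measurable (firstNot p) := by
  refine measurable_of_Ioi fun k => ?_
  have : firstNot p ⁻¹' Set.Ioi k =
      (⋃ i, {x | x i = p - 1}ᶜ) ∩ ⋂ i, ⋂ _ : i ≤ k, {x | x i = p - 1} := by
    ext x
    simp [lt_firstNot_iff]
  rw [this]
  exact (MeasurableSet.iUnion fun i => (measurableSet_apply_eq i _).compl).inter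
    (.iInter fun _ => .iInter fun _ => measurableSet_apply_eq _ _)

theorem measurable_odo (p : ℕ) : Measurable (odo p) := by
  refine measurable_pi_iff.2 fun i => ?_
  refine Measurable.ite (measurable_firstNot p measurableSet_Ioi) measurable_const ?_
  refine Measurable.ite ?_ ?_ (measurable_pi_apply i)
  · have : {x | i = firstNot p x} = firstNot p ⁻¹' {i} := by ext; simp [eq_comm]
    rw [this]
    exact measurable_firstNot p (measurableSet_singleton i)
  · exact (measurable_pi_apply i).add_const 1

theorem measurable_phiOmega (p : ℕ) (ω : ℕ → ℕ) : Measurable (phiOmega p ω) := by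
  refine measurable_to_countable' fun c => ?_
  have : phiOmega p ω ⁻¹' {c} =
      ⋃ k, firstNot p ⁻¹' {k} ∩ (fun x : ℕ → ℕ => x k) ⁻¹' (ω ⁻¹' {c}) := by
    ext x
    simp [phiOmega]
  rw [this]
  exact .iUnion fun k => (measurable_firstNot p (measurableSet_singleton k)).inter
    (measurable_pi_apply k .of_discrete)

theorem measurable_phiOmegaSum (p : ℕ) (ω : ℕ → ℕ) (m : ℕ) : Measurable (phiOmegaSum p ω m) :=
  Finset.measurable_sum _ fun j _ => (measurable_phiOmega p ω).comp ((measurable_odo p).iterate j)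

theorem measurable_digitsOf (p : ℕ) : Measurable (digitsOf p) :=
  measurable_pi_iff.2 fun _ => (measurable_of_countable fun k : ℤ => k.toNat % p).comp
    (Int.measurable_floor.comp (measurable_id.mul_const _))

instance isProbabilityMeasure_lam (p : ℕ) : IsProbabilityMeasure (lam p) := by
  have : IsProbabilityMeasure (volume.restrict (Set.Ico (0 : ℝ) 1)) := ⟨by simp⟩
  exact Measure.isProbabilityMeasure_map (measurable_digitsOf p).aemeasurable

/-- The natural number whose base-`p` digits, most significant first, are `d_0, …, d_{n-1}`. -/
def prefixValue (p : ℕ) (d : ℕ → ℕ) : ℕ → ℕ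
  | 0 => 0
  | n + 1 => p * prefixValue p d n + d n

theorem prefixValue_lt {p : ℕ} {d : ℕ → ℕ} (hd : ∀ i, d i < p) (n : ℕ) :
    prefixValue p d n < p ^ n := by
  induction n with
  | zero => simp [prefixValue]
  | succ n ih =>
    have h := hd n
    have : p * (prefixValue p d n + 1) ≤ p * p ^ n := Nat.mul_le_mul_left p ih
    rw [prefixValue, pow_succ']
    linarith

theorem digitsOf_mem_cyl_iff {p : ℕ} {d : ℕ → ℕ} (hd : ∀ i, d i < p) {u : ℝ}
    (hu : u ∈ Set.Ico (0 : ℝ) 1) (n : ℕ) :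
    digitsOf p u ∈ cyl n d ↔ ⌊u * (p : ℝ) ^ n⌋₊ = prefixValue p d n := by
  have hp : 0 < p := (Nat.zero_le _).trans_lt (hd 0)
  induction n with
  | zero => simp [cyl, prefixValue, hu.2]
  | succ n ih =>
    have hdiv : ⌊u * (p : ℝ) ^ (n + 1)⌋₊ / p = ⌊u * (p : ℝ) ^ n⌋₊ := by
      rw [← Nat.floor_div_natCast, pow_succ]
      congr 1
      field_simp
    have hsucc : digitsOf p u ∈ cyl (n + 1) d ↔
        digitsOf p u ∈ cyl n d ∧ digitsOf p u n = d n := by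
      exact Nat.forall_lt_succ_right
    rw [hsucc, and_congr_left' ih, ← hdiv, digitsOf, Int.floor_toNat, prefixValue]
    have hdn := hd n
    have hm := Nat.div_add_mod ⌊u * (p : ℝ) ^ (n + 1)⌋₊ p
    constructor
    · rintro ⟨h1, h2⟩
      rw [← hm, h1, h2]
    · intro h
      rw [h]
      constructor
      · rw [Nat.mul_add_div hp, Nat.div_eq_of_lt hdn, add_zero]
      · rw [Nat.mul_add_mod, Nat.mod_eq_of_lt hdn]

theorem lam_cyl {p : ℕ} {d : ℕ → ℕ} (hd : ∀ i, d i < p) (n : ℕ) :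
    lam p (cyl n d) = ENNReal.ofReal (1 / (p : ℝ) ^ n) := by
  have hp : 0 < p := (Nat.zero_le _).trans_lt (hd 0)
  have hpn : (0 : ℝ) < (p : ℝ) ^ n := by positivity
  have hlt : ((prefixValue p d n : ℝ) + 1) ≤ (p : ℝ) ^ n := by
    exact_mod_cast prefixValue_lt hd n
  have hset : digitsOf p ⁻¹' cyl n d ∩ Set.Ico (0 : ℝ) 1 =
      Set.Ico ((prefixValue p d n : ℝ) / (p : ℝ) ^ n)
        (((prefixValue p d n : ℝ) + 1) / (p : ℝ) ^ n) := by
    ext u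
    constructor
    · rintro ⟨h, hu⟩
      rw [Set.mem_preimage, digitsOf_mem_cyl_iff hd hu,
        Nat.floor_eq_iff (mul_nonneg hu.1 hpn.le)] at h
      exact ⟨(div_le_iff₀ hpn).2 h.1, (lt_div_iff₀ hpn).2 h.2⟩
    · rintro ⟨h1, h2⟩
      have hu : u ∈ Set.Ico (0 : ℝ) 1 :=
        ⟨le_trans (by positivity) h1, h2.trans_le ((div_le_one hpn).2 hlt)⟩
      refine ⟨?_, hu⟩
      rw [Set.mem_preimage, digitsOf_mem_cyl_iff hd hu,
        Nat.floor_eq_iff (mul_nonneg hu.1 hpn.le)]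
      exact ⟨(div_le_iff₀ hpn).1 h1, (lt_div_iff₀ hpn).1 h2⟩
  rw [lam, Measure.map_apply (measurable_digitsOf p) (measurableSet_cyl n d),
    Measure.restrict_apply (measurable_digitsOf p (measurableSet_cyl n d)), hset,
    Real.volume_Ico]
  congr 1
  ring

theorem measurableSet_forall_lt (p : ℕ) : MeasurableSet {x : ℕ → ℕ | ∀ i, x i < p} := by
  have : {x : ℕ → ℕ | ∀ i, x i < p} = ⋂ i, (fun x : ℕ → ℕ => x i) ⁻¹' Set.Iio p := by
    ext; simp
  rw [this]
  exact .iInter fun i => measurable_pi_apply i measurableSet_Iio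

theorem ae_lam_mem_gammaNe {p : ℕ} (hp : 2 ≤ p) : ∀ᵐ x ∂lam p, x ∈ GammaNe p := by
  have h1 : ∀ᵐ x ∂lam p, ∀ i, x i < p := by
    rw [lam, ae_map_iff (measurable_digitsOf p).aemeasurable (measurableSet_forall_lt p)]
    exact .of_forall fun u i => Nat.mod_lt _ (by omega)
  have h2 : ∀ᵐ x ∂lam p, ∃ i, x i ≠ p - 1 := by
    rw [ae_iff]
    have hle : ∀ n : ℕ, lam p {x | ¬∃ i, x i ≠ p - 1} ≤ ENNReal.ofReal ((1 / (p : ℝ)) ^ n) := by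
      intro n
      rw [one_div_pow, ← lam_cyl (d := fun _ => p - 1) (fun _ => by omega)]
      refine measure_mono fun x hx i _ => ?_
      by_contra h
      exact hx ⟨i, h⟩
    have hp' : (2 : ℝ) ≤ p := by exact_mod_cast hp
    have hlim : Filter.Tendsto (fun n : ℕ => ENNReal.ofReal ((1 / (p : ℝ)) ^ n))
        Filter.atTop (nhds 0) := by
      rw [← ENNReal.ofReal_zero]
      refine ENNReal.tendsto_ofReal (tendsto_pow_atTop_nhds_zero_of_lt_one (by positivity) ?_)
      rw [div_lt_one (by linarith)]
      linarith
    exact le_antisymm (ge_of_tendsto' hlim hle) zero_le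
  filter_upwards [h1, h2] with x hx1 hx2 using ⟨hx1, hx2⟩

theorem ext_of_cyl {μ ν : Measure (ℕ → ℕ)} [IsProbabilityMeasure μ] [IsProbabilityMeasure ν]
    (h : ∀ n d, μ (cyl n d) = ν (cyl n d)) : μ = ν := by
  refine ext_of_generate_finite {s | ∃ n d, s = cyl n d} ?_ ?_ ?_ (by simp)
  · refine le_antisymm ?_ (MeasurableSpace.generateFrom_le ?_)
    · refine iSup_le fun i => ?_
      rintro _ ⟨t, -, rfl⟩
      have : (fun x : ℕ → ℕ => x i) ⁻¹' t = ⋃ (v : Fin (i + 1) → ℕ) (_ : v (Fin.last i) ∈ t),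
          cyl (i + 1) (fun k => if hk : k < i + 1 then v ⟨k, hk⟩ else 0) := by
        ext x
        simp only [Set.mem_preimage, Set.mem_iUnion, cyl, Set.mem_ofPred_eq]
        constructor
        · intro hx
          exact ⟨fun k => x k, hx, fun k hk => by simp [hk]⟩
        · rintro ⟨v, hv, hx⟩
          rw [hx i (by omega), dif_pos (by omega)]
          exact hv
      rw [this]
      exact MeasurableSet.iUnion fun v => MeasurableSet.iUnion fun _ =>
        MeasurableSpace.measurableSet_generateFrom ⟨_, _, rfl⟩
    · rintro _ ⟨n, d, rfl⟩
      exact measurableSet_cyl n d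
  · rintro _ ⟨n, d, rfl⟩ _ ⟨n', d', rfl⟩ ⟨x, hx, hx'⟩
    refine ⟨max n n', x, ?_⟩
    ext y
    constructor
    · rintro ⟨hy, hy'⟩ i hi
      rcases lt_max_iff.1 hi with hi | hi
      · rw [hy i hi, hx i hi]
      · rw [hy' i hi, hx' i hi]
    · intro hy
      exact ⟨fun i hi => by rw [hy i (lt_max_of_lt_left hi), hx i hi],
        fun i hi => by rw [hy i (lt_max_of_lt_right hi), hx' i hi]⟩
  · rintro _ ⟨n, d, rfl⟩
    exact h n d

theorem measurePreserving_of_cyl {p : ℕ} (hp : 2 ≤ p) {f : (ℕ → ℕ) → ℕ → ℕ} (hf : Measurable f)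
    (hlt : ∀ x ∈ GammaNe p, ∀ i, f x i < p)
    (hcyl : ∀ (n : ℕ) (d : ℕ → ℕ), (∀ i, d i < p) → (∃ i, d i ≠ 0) →
      ∃ d' : ℕ → ℕ, (∀ i, d' i < p) ∧ ∀ x ∈ GammaNe p, (f x ∈ cyl n d ↔ x ∈ cyl n d')) :
    MeasurePreserving f (lam p) (lam p) := by
  refine ⟨hf, ?_⟩
  have : IsProbabilityMeasure ((lam p).map f) :=
    Measure.isProbabilityMeasure_map hf.aemeasurable
  refine ext_of_cyl fun n d => ?_
  rw [Measure.map_apply hf (measurableSet_cyl n d)]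
  by_cases hd : ∀ i < n, d i < p
  · set e : ℕ → ℕ := fun i => if i < n then d i else 1 with he
    have hcyl_e : cyl n d = cyl n e := by
      ext x
      exact forall₂_congr fun i hi => by simp [he, hi]
    have hlt_e : ∀ i, e i < p := by
      intro i
      by_cases hi : i < n
      · simpa [he, hi] using hd i hi
      · simp only [he, hi, if_false]
        omega
    obtain ⟨d', hd', hiff⟩ := hcyl n e hlt_e ⟨n, by simp [he]⟩
    rw [hcyl_e, lam_cyl hlt_e, ← lam_cyl hd']
    refine measure_congr ?_
    filter_upwards [ae_lam_mem_gammaNe hp] with x hx using propext (hiff x hx)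
  · push Not at hd
    obtain ⟨i, hi, hdi⟩ := hd
    have h1 : lam p (f ⁻¹' cyl n d) = 0 := by
      refine measure_eq_zero_iff_ae_notMem.2 ?_
      filter_upwards [ae_lam_mem_gammaNe hp] with x hx hmem
      exact absurd (hlt x hx i) (by rw [hmem i hi]; omega)
    have h2 : lam p (cyl n d) = 0 := by
      refine measure_eq_zero_iff_ae_notMem.2 ?_
      filter_upwards [ae_lam_mem_gammaNe hp] with x hx hmem
      exact absurd (hx.1 i) (by rw [hmem i hi]; omega)
    rw [h1, h2]

theorem measurePreserving_odo {p : ℕ} (hp : 2 ≤ p) :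
    MeasurePreserving (odo p) (lam p) (lam p) :=
  measurePreserving_of_cyl hp (measurable_odo p) (fun _ hx => odo_lt hx) fun _ d hd hd' =>
    ⟨compl p (odo p (compl p d)), compl_lt (by omega) _,
      fun _ hx => odo_mem_cyl_iff hp hx hd hd'⟩

theorem measurePreserving_compl {p : ℕ} (hp : 2 ≤ p) :
    MeasurePreserving (compl p) (lam p) (lam p) :=
  measurePreserving_of_cyl hp (measurable_compl p) (fun x _ => compl_lt (by omega) x)
    fun _ d hd _ => ⟨compl p d, compl_lt (by omega) d, fun _ hx => compl_mem_cyl_iff hx.1 hd⟩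

theorem phiOmega_compl_odo_add {p c : ℕ} (hp : 2 ≤ p) {ω : ℕ → ℕ}
    (hω : ∀ j ≤ p - 2, ω j + ω (p - 2 - j) = c) {x : ℕ → ℕ} (hx : x ∈ GammaNe p) :
    phiOmega p ω (compl p (odo p x)) + phiOmega p ω x = c := by
  have h1 := hx.1 (firstNot p x)
  have h2 := apply_firstNot_ne hx.2
  rw [phiOmega, firstNot_compl_odo hp, compl_odo_apply_firstNot, add_comm, phiOmega]
  exact hω _ (by omega)

theorem odo_iterate_compl {p : ℕ} (hp : 2 ≤ p) {x : ℕ → ℕ}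
    (hx : ∀ k, (odo p)^[k] x ∈ GammaNe p) (n k : ℕ) :
    (odo p)^[k] (compl p ((odo p)^[n + k] x)) = compl p ((odo p)^[n] x) := by
  induction k with
  | zero => rfl
  | succ k ih =>
    rw [Function.iterate_succ_apply, ← add_assoc, Function.iterate_succ_apply',
      odo_compl_odo hp (hx _), ih]

theorem phiOmegaSum_compl_add {p c : ℕ} (hp : 2 ≤ p) {ω : ℕ → ℕ}
    (hω : ∀ j ≤ p - 2, ω j + ω (p - 2 - j) = c) {x : ℕ → ℕ}
    (hx : ∀ k, (odo p)^[k] x ∈ GammaNe p) (m : ℕ) :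
    phiOmegaSum p ω m (compl p ((odo p)^[m] x)) + phiOmegaSum p ω m x = m * c := by
  have hrefl : phiOmegaSum p ω m x =
      ∑ k ∈ Finset.range m, phiOmega p ω ((odo p)^[m - 1 - k] x) :=
    (Finset.sum_range_reflect (fun k => phiOmega p ω ((odo p)^[k] x)) m).symm
  rw [hrefl, phiOmegaSum, ← Finset.sum_add_distrib]
  refine (Finset.sum_congr rfl fun k hk => ?_).trans
    (by simp : ∑ _k ∈ Finset.range m, c = m * c)
  have hk' := Finset.mem_range.1 hk
  have h := odo_iterate_compl hp hx (m - 1 - k + 1) k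
  rw [show m - 1 - k + 1 + k = m by omega, Function.iterate_succ_apply'] at h
  rw [h]
  exact phiOmega_compl_odo_add hp hω (hx _)

theorem pimOmega_eq_of_add_eq {p c : ℕ} (hp : 2 ≤ p) {ω : ℕ → ℕ}
    (hω : ∀ j ≤ p - 2, ω j + ω (p - 2 - j) = c) {m i j : ℕ} (hij : i + j = m * c) :
    pimOmega p ω m i = pimOmega p ω m j := by
  have hS := measurePreserving_odo hp
  have hT := (measurePreserving_compl hp).comp (hS.iterate m)
  have hgood : ∀ᵐ x ∂lam p, ∀ k, (odo p)^[k] x ∈ GammaNe p :=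
    ae_all_iff.2 fun k => (hS.iterate k).quasiMeasurePreserving.ae (ae_lam_mem_gammaNe hp)
  change lam p (phiOmegaSum p ω m ⁻¹' {i}) = lam p (phiOmegaSum p ω m ⁻¹' {j})
  rw [← hT.measure_preimage
    (measurable_phiOmegaSum p ω m (measurableSet_singleton j)).nullMeasurableSet]
  refine measure_congr ?_
  filter_upwards [hgood] with x hx
  refine propext ?_
  have h := phiOmegaSum_compl_add hp hω hx m
  change phiOmegaSum p ω m x = i ↔ phiOmegaSum p ω m (compl p ((odo p)^[m] x)) = j
  omega

/-- if `ω` is antipalindromic with range `{0, …, ζ}`, `a > 0`, `b ≥ 0`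
and `ω' (j) = a ω(j) + b`, then `π_m^{ω'}(mb + j) = π_m^{ω'}(m(aζ + b) - j)` for
all `m ≥ 0` and all `0 ≤ j ≤ m a ζ`. -/
theorem statement_3 (p : ℕ) (hp : 3 ≤ p) (ζ : ℕ) (ω : ℕ → ℕ)
    (hω : Antipalindromic p ζ ω) (a b : ℕ) (ha : 0 < a)
    (m j : ℕ) (hj : j ≤ m * (a * ζ)) :
    pimOmega p (fun n => a * ω n + b) m (m * b + j) =
      pimOmega p (fun n => a * ω n + b) m (m * (a * ζ + b) - j) := by
  obtain ⟨-, -, hsum⟩ := hω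
  refine pimOmega_eq_of_add_eq (c := a * ζ + 2 * b) (by omega) (fun k hk => ?_) ?_
  · rw [← hsum k hk]
    ring
  · have h1 : m * (a * ζ + b) = m * (a * ζ) + m * b := by ring
    have h2 : m * (a * ζ + 2 * b) = m * (a * ζ) + m * b + m * b := by ring
    omega

end Chacon
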